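/- Suppose n − |τ₀| > 4. For any δ > 0 there exists a constant γ_δ > 0 such that whenever the tuning parameter satisfies λ ∈ [n·γ_δ^{1/2}·{2 + 2(|τ₀|+1)log(p/2)/n}, n·γ_δ^{1/4}·C_min/6], the probability that the true model is not included in the candidate set satisfies ℙ_{(𝒰^d,Y)}(τ₀ ∉ S^(d)) ≤ (1 − γ_δ^{n−1}/(n−1))^d + δ. Consequently, as d → ∞, ℙ_{(𝒰^d,Y)}(τ₀ ∉ S^(d)) is eventually at most δ, where δ > 0 is arbitrarily small. -/

import Mathlib

open MeasureTheory ProbabilityTheory Matrix Filter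
open scoped ENNReal Classical

noncomputable section

namespace ReproSamples

/-- Squared Euclidean norm of a vector in `ℝⁿ`. -/
def sqnorm {n : ℕ} (v : Fin n → ℝ) : ℝ := ∑ i, (v i) ^ 2

/-- The vector `β` with all coordinates outside `τ` set to `0`; this encodes the
vector `β_τ ∈ ℝ^{|τ|}`, so that `X_τ β_τ = X.mulVec (maskOn τ β)`. -/
def maskOn {p : ℕ} (τ : Finset (Fin p)) (β : Fin p → ℝ) : Fin p → ℝ :=
  fun j => if j ∈ τ then β j else 0

/-- The submatrix `X_τ` of the columns of `X` indexed by `τ`. -/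
def subcols {n p : ℕ} (X : Matrix (Fin n) (Fin p) ℝ) (τ : Finset (Fin p)) :
    Matrix (Fin n) {j // j ∈ τ} ℝ :=
  Matrix.of fun i j => X i j.1

/-- The matrix `M (MᵀM)⁻¹ Mᵀ` (orthogonal projection onto the column span of `M`
when `MᵀM` is invertible). -/
def projMat {n : ℕ} {m : Type} [Fintype m] [DecidableEq m]
    (M : Matrix (Fin n) m ℝ) : Matrix (Fin n) (Fin n) ℝ :=
  M * (Mᵀ * M)⁻¹ * Mᵀ

/-- The projection matrix `H_τ = X_τ (X_τᵀ X_τ)⁻¹ X_τᵀ`. -/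
def proj {n p : ℕ} (X : Matrix (Fin n) (Fin p) ℝ) (τ : Finset (Fin p)) :
    Matrix (Fin n) (Fin n) ℝ :=
  projMat (subcols X τ)

/-- Identifiability: `τ₀` is the unique minimizer of `|τ|` over
`{τ : X_τ β_τ = X_{τ₀} β₀ for some β_τ}` (here `β₀` is supported on `τ₀`). -/
def Identifiable {n p : ℕ} (X : Matrix (Fin n) (Fin p) ℝ) (τ₀ : Finset (Fin p))
    (β₀ : Fin p → ℝ) : Prop :=
  ∀ τ : Finset (Fin p), (∃ β : Fin p → ℝ, X.mulVec (maskOn τ β) = X.mulVec β₀) →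
    τ ≠ τ₀ → τ₀.card < τ.card

/-- The separation constant `C_min`. -/
def Cmin {n p : ℕ} (X : Matrix (Fin n) (Fin p) ℝ) (τ₀ : Finset (Fin p))
    (β₀ : Fin p → ℝ) : ℝ :=
  sInf ((fun τ : Finset (Fin p) =>
      sqnorm ((1 - proj X τ).mulVec (X.mulVec β₀)) /
        ((n * max (τ₀ \ τ).card 1 : ℕ) : ℝ)) ''
    {τ : Finset (Fin p) | τ ≠ τ₀ ∧ τ.card ≤ τ₀.card})

/-- Penalized objective `min_{β_τ, σ} ‖y − X_τ β_τ − σ u*‖² + λ|τ|`. -/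
def objPen {n p : ℕ} (X : Matrix (Fin n) (Fin p) ℝ) (lam : ℝ) (y ustar : Fin n → ℝ)
    (τ : Finset (Fin p)) : ℝ :=
  (⨅ bs : (Fin p → ℝ) × ℝ, sqnorm (y - X.mulVec (maskOn τ bs.1) - bs.2 • ustar)) +
    lam * τ.card

/-- Un-penalized objective `min_{β_τ, σ} ‖y − X_τ β_τ − σ u*‖²`. -/
def objFit {n p : ℕ} (X : Matrix (Fin n) (Fin p) ℝ) (y ustar : Fin n → ℝ)
    (τ : Finset (Fin p)) : ℝ :=
  ⨅ bs : (Fin p → ℝ) × ℝ, sqnorm (y - X.mulVec (maskOn τ bs.1) - bs.2 • ustar)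

/-- Standard Gaussian measure `N(0, I_n)` on `ℝⁿ`. -/
def stdGaussian (n : ℕ) : Measure (Fin n → ℝ) :=
  Measure.pi fun _ => gaussianReal 0 1

/-- Joint law of `(U, (U*_1, …, U*_d))`, all i.i.d. `N(0, I_n)`. -/
def jointMeasure (n d : ℕ) : Measure ((Fin n → ℝ) × (Fin d → Fin n → ℝ)) :=
  (stdGaussian n).prod (Measure.pi fun _ : Fin d => stdGaussian n)

/-- Squared cosine of the angle between two vectors. -/
def rho {n : ℕ} (v w : Fin n → ℝ) : ℝ := (v ⬝ᵥ w) ^ 2 / (sqnorm v * sqnorm w)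

/-- `ρ_{τ⊥}(v, w) = ρ((I−H_τ)v, (I−H_τ)w)`. -/
def rhoPerp {n p : ℕ} (X : Matrix (Fin n) (Fin p) ℝ) (τ : Finset (Fin p))
    (v w : Fin n → ℝ) : ℝ :=
  rho ((1 - proj X τ).mulVec v) ((1 - proj X τ).mulVec w)

/-- `ρ(v, τ) = ‖H_τ v‖²/‖v‖²`. -/
def rhoTau {n p : ℕ} (X : Matrix (Fin n) (Fin p) ℝ) (v : Fin n → ℝ)
    (τ : Finset (Fin p)) : ℝ :=
  sqnorm ((proj X τ).mulVec v) / sqnorm v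

/-- The augmented matrix `(X_τ, u)`. -/
def augcols {n p : ℕ} (X : Matrix (Fin n) (Fin p) ℝ) (τ : Finset (Fin p))
    (u : Fin n → ℝ) : Matrix (Fin n) ({j // j ∈ τ} ⊕ Unit) ℝ :=
  Matrix.of fun i j => Sum.elim (fun k : {j // j ∈ τ} => X i k.1) (fun _ => u i) j

/-- The projection matrix `H_{τ,u}` onto the column span of `(X_τ, u)`. -/
def projAug {n p : ℕ} (X : Matrix (Fin n) (Fin p) ℝ) (τ : Finset (Fin p))
    (u : Fin n → ℝ) : Matrix (Fin n) (Fin n) ℝ :=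
  projMat (augcols X τ u)

/-- `γ²_{(u, τ₀)} = 1 − min_{|τ| < |τ₀|} ‖(I−H_{τ,u})X_{τ₀}β₀‖²/‖(I−H_τ)X_{τ₀}β₀‖²`. -/
def gammaSq {n p : ℕ} (X : Matrix (Fin n) (Fin p) ℝ) (τ₀ : Finset (Fin p))
    (β₀ : Fin p → ℝ) (u : Fin n → ℝ) : ℝ :=
  1 - sInf ((fun τ : Finset (Fin p) =>
      sqnorm ((1 - projAug X τ u).mulVec (X.mulVec β₀)) /
        sqnorm ((1 - proj X τ).mulVec (X.mulVec β₀))) ''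
    {τ : Finset (Fin p) | τ.card < τ₀.card})

/-- Residual sum of squares `min_β ‖y − X_τ β‖²`. -/
def rss {n p : ℕ} (X : Matrix (Fin n) (Fin p) ℝ) (y : Fin n → ℝ)
    (τ : Finset (Fin p)) : ℝ :=
  ⨅ β : Fin p → ℝ, sqnorm (y - X.mulVec (maskOn τ β))

/-- `Y*_w = a + b (I−H_τ)u / ‖(I−H_τ)u‖`. -/
def ystar {n p : ℕ} (X : Matrix (Fin n) (Fin p) ℝ) (τ : Finset (Fin p))
    (a : Fin n → ℝ) (b : ℝ) (u : Fin n → ℝ) : Fin n → ℝ :=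
  a + (b / Real.sqrt (sqnorm ((1 - proj X τ).mulVec u))) • ((1 - proj X τ).mulVec u)

/-- `p_{(w,τ)}(τ') = ℙ(T̃(Y*_w, τ) = τ')`. -/
def pfun {n p : ℕ} (X : Matrix (Fin n) (Fin p) ℝ)
    (Tt : (Fin n → ℝ) → Finset (Fin p) → Finset (Fin p))
    (τ : Finset (Fin p)) (a : Fin n → ℝ) (b : ℝ) (τ' : Finset (Fin p)) : ℝ :=
  ((stdGaussian n) {u | Tt (ystar X τ a b u) τ = τ'}).toReal

/-- `B_α(τ, w) = {τ* : ∑_{τ' : p(τ') ≤ p(τ*)} p(τ') ≥ 1 − α}`. -/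
def Bset {n p : ℕ} (X : Matrix (Fin n) (Fin p) ℝ)
    (Tt : (Fin n → ℝ) → Finset (Fin p) → Finset (Fin p)) (α : ℝ)
    (τ : Finset (Fin p)) (a : Fin n → ℝ) (b : ℝ) : Set (Finset (Fin p)) :=
  {τstar | 1 - α ≤
    ∑ τ' ∈ Finset.univ.filter (fun τ' => pfun X Tt τ a b τ' ≤ pfun X Tt τ a b τstar),
      pfun X Tt τ a b τ'}

/-- `τ ∈ Γ̄^τ_α(y)`-membership test: `T̃(y,τ) ∈ B_α(τ, W̃(y,τ))` with
`W̃(y,τ) = (H_τ y, ‖(I−H_τ)y‖)`. -/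
def inCS {n p : ℕ} (X : Matrix (Fin n) (Fin p) ℝ)
    (Tt : (Fin n → ℝ) → Finset (Fin p) → Finset (Fin p)) (α : ℝ)
    (y : Fin n → ℝ) (τ : Finset (Fin p)) : Prop :=
  Tt y τ ∈ Bset X Tt α τ ((proj X τ).mulVec y)
    (Real.sqrt (sqnorm ((1 - proj X τ).mulVec y)))

/-- `O_{τ,Λ}`: orthogonal projection onto the column span of `(I−H_{τ∖Λ}) X_{Λ∩τ}`. -/
def projO {n p : ℕ} (X : Matrix (Fin n) (Fin p) ℝ) (τ Λ : Finset (Fin p)) :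
    Matrix (Fin n) (Fin n) ℝ :=
  projMat ((1 - proj X (τ \ Λ)) * subcols X (Λ ∩ τ))

/-- The nuclear mapping `T̃(y, (β_Λ, τ))` with values in `EReal` (it takes the value
`⊤ = +∞` when `β_i ≠ 0` for some `i ∈ Λ ∖ τ`). -/
def Tnuc {n p : ℕ} (X : Matrix (Fin n) (Fin p) ℝ) (Λ τ : Finset (Fin p))
    (β : Fin p → ℝ) (y : Fin n → ℝ) : EReal :=
  if ∃ i ∈ Λ \ τ, β i ≠ 0 then ⊤
  else if Λ ∩ τ = ∅ then 0
  else ((((y - X.mulVec (maskOn Λ β)) ⬝ᵥ (projO X τ Λ).mulVec (y - X.mulVec (maskOn Λ β))) /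
    (((y - X.mulVec (maskOn Λ β)) ⬝ᵥ (1 - proj X τ).mulVec (y - X.mulVec (maskOn Λ β))) /
      ((n : ℝ) - τ.card)) : ℝ) : EReal)

/-- The statistic `u ↦ (uᵀ O_{τ,Λ} u)/(uᵀ(I−H_τ)u/(n−|τ|))`. -/
def fstat {n p : ℕ} (X : Matrix (Fin n) (Fin p) ℝ) (τ Λ : Finset (Fin p))
    (u : Fin n → ℝ) : ℝ :=
  (u ⬝ᵥ (projO X τ Λ).mulVec u) / ((u ⬝ᵥ (1 - proj X τ).mulVec u) / ((n : ℝ) - τ.card))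

/-- The `α`-quantile `q_α(τ, Λ)` of the law of `fstat` under `N(0, I_n)`. -/
def qant {n p : ℕ} (X : Matrix (Fin n) (Fin p) ℝ) (τ Λ : Finset (Fin p)) (α : ℝ) : ℝ :=
  sInf {x : ℝ | α ≤ (((stdGaussian n).map (fstat X τ Λ)) (Set.Iic x)).toReal}


lemma pi_ac (ν ρ : Measure ℝ) [SigmaFinite ν] [SigmaFinite ρ] (h : ν ≪ ρ) (n : ℕ) :
    (Measure.pi fun _ : Fin n => ν) ≪ (Measure.pi fun _ : Fin n => ρ) := by
  induction n with
  | zero =>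
    rw [Measure.pi_of_empty, Measure.pi_of_empty]
  | succ n ih =>
    have h1 := (measurePreserving_piFinSuccAbove (fun _ : Fin (n+1) => ν) 0).symm
    have h2 := (measurePreserving_piFinSuccAbove (fun _ : Fin (n+1) => ρ) 0).symm
    rw [← h1.map_eq, ← h2.map_eq]
    exact (h.prod ih).map h1.measurable

instance (n : ℕ) : IsProbabilityMeasure (stdGaussian n) := by
  unfold stdGaussian; infer_instance

lemma stdGaussian_ac (n : ℕ) : stdGaussian n ≪ volume := by
  rw [volume_pi]
  exact pi_ac _ _ (gaussianReal_absolutelyContinuous 0 one_ne_zero) n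

lemma stdGaussian_submodule {n : ℕ} (W : Submodule ℝ (Fin n → ℝ)) (hW : W ≠ ⊤) :
    stdGaussian n (W : Set (Fin n → ℝ)) = 0 :=
  stdGaussian_ac n (Measure.addHaar_submodule volume W hW)

lemma dist_lb {n : ℕ} (S : Submodule ℝ (Fin n → ℝ)) (v : Fin n → ℝ) (hv : v ∉ S) :
    ∃ η : ℝ, 0 < η ∧ ∀ w ∈ S, η ≤ ‖v - w‖ := by
  have hc : IsClosed (S : Set (Fin n → ℝ)) := S.closed_of_finiteDimensional
  refine ⟨Metric.infDist v S, (hc.notMem_iff_infDist_pos ⟨0, S.zero_mem⟩).1 hv, ?_⟩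
  intro w hw
  rw [← dist_eq_norm]
  exact Metric.infDist_le_dist_of_mem hw

lemma fit_lb {n : ℕ} (W : Submodule ℝ (Fin n → ℝ)) (x u : Fin n → ℝ) (σ : ℝ) (hσ : 0 < σ)
    (hx : x ∉ W) (hu : u ∉ W ⊔ Submodule.span ℝ {x}) :
    ∃ ε : ℝ, 0 < ε ∧ ∀ e : Fin n → ℝ, ‖e‖ ≤ ε → ∀ w ∈ W, ∀ s : ℝ,
      ε ≤ ‖x + σ • u - w - s • (u + e)‖ ^ 2 := by
  have hx' : x ∉ W ⊔ Submodule.span ℝ {u} := by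
    intro h
    obtain ⟨w, hw, z, hz, hwz⟩ := Submodule.mem_sup.1 h
    obtain ⟨a, rfl⟩ := Submodule.mem_span_singleton.1 hz
    by_cases ha : a = 0
    · subst ha
      apply hx
      rw [← hwz]
      simpa using hw
    · apply hu
      refine Submodule.mem_sup.2 ⟨-(a⁻¹ • w), W.neg_mem (W.smul_mem _ hw), a⁻¹ • x,
        Submodule.mem_span_singleton.2 ⟨_, rfl⟩, ?_⟩
      rw [← hwz, smul_add, smul_smul, inv_mul_cancel₀ ha]
      simp
  obtain ⟨η₁, h1, H1⟩ := dist_lb _ _ hu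
  obtain ⟨η₂, h2, H2⟩ := dist_lb _ _ hx'
  set r := min (σ * η₁) (η₂ / 2) with hr
  have hrpos : 0 < r := lt_min (by positivity) (by positivity)
  refine ⟨min (min (η₁ / 2) (η₂ / (8 * σ))) (r ^ 2), by positivity, ?_⟩
  intro e he w hw s
  have he1 : ‖e‖ ≤ η₁ / 2 := he.trans ((min_le_left _ _).trans (min_le_left _ _))
  have he2 : ‖e‖ ≤ η₂ / (8 * σ) := he.trans ((min_le_left _ _).trans (min_le_right _ _))
  have he2' : 8 * σ * ‖e‖ ≤ η₂ := by
    rw [le_div_iff₀ (by positivity)] at he2; linarith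
  refine (min_le_right _ _).trans ?_
  refine pow_le_pow_left₀ hrpos.le ?_ 2
  set z := x + (σ - s) • u - w with hz
  have hv : x + σ • u - w - s • (u + e) = z - s • e := by
    rw [hz]; module
  have hvz : ‖z‖ - |s| * ‖e‖ ≤ ‖x + σ • u - w - s • (u + e)‖ := by
    rw [hv, ← Real.norm_eq_abs, ← norm_smul]
    exact norm_sub_norm_le _ _
  have hzx : η₂ ≤ ‖z‖ := by
    have := H2 (w - (σ - s) • u) (Submodule.sub_mem _ (Submodule.mem_sup_left hw)
      (Submodule.mem_sup_right (Submodule.mem_span_singleton.2 ⟨_, rfl⟩)))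
    convert this using 2
    rw [hz]; module
  have hzu : |σ - s| * η₁ ≤ ‖z‖ := by
    by_cases h0 : σ - s = 0
    · rw [h0]; simp
    · have := H1 ((σ - s)⁻¹ • (w - x)) (Submodule.smul_mem _ _
        (Submodule.sub_mem _ (Submodule.mem_sup_left hw)
        (Submodule.mem_sup_right (Submodule.mem_span_singleton_self x))))
      have hz2 : z = (σ - s) • (u - (σ - s)⁻¹ • (w - x)) := by
        rw [smul_sub, smul_smul, mul_inv_cancel₀ h0, hz]; module
      rw [hz2, norm_smul, Real.norm_eq_abs]
      gcongr
  refine le_trans ?_ hvz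
  rcases le_or_gt |s| (4 * σ) with hs | hs
  · refine (min_le_right _ _).trans ?_
    nlinarith [norm_nonneg e]
  · refine (min_le_left _ _).trans ?_
    have h3 : |s| - σ ≤ |σ - s| := by
      have := abs_sub_abs_le_abs_sub s σ
      rw [abs_of_pos hσ, abs_sub_comm] at this
      exact this
    nlinarith [norm_nonneg e, abs_nonneg s, mul_le_mul_of_nonneg_left he1 (abs_nonneg s), mul_le_mul_of_nonneg_right h3 h1.le]

lemma norm_sq_le_sqnorm {n : ℕ} (v : Fin n → ℝ) : ‖v‖ ^ 2 ≤ sqnorm v := by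
  have h0 : 0 ≤ sqnorm v := Finset.sum_nonneg fun i _ => sq_nonneg _
  rw [← Real.le_sqrt (norm_nonneg _) h0, pi_norm_le_iff_of_nonneg (Real.sqrt_nonneg _)]
  intro i
  rw [Real.le_sqrt (norm_nonneg _) h0, Real.norm_eq_abs, sq_abs]
  exact Finset.single_le_sum (f := fun i => (v i)^2) (fun i _ => sq_nonneg _) (Finset.mem_univ i)

lemma sqnorm_le {n : ℕ} (v : Fin n → ℝ) : sqnorm v ≤ n * ‖v‖ ^ 2 := by
  have : sqnorm v ≤ ∑ _i : Fin n, ‖v‖ ^ 2 := by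
    refine Finset.sum_le_sum fun i _ => ?_
    rw [← sq_abs, ← Real.norm_eq_abs]
    exact pow_le_pow_left₀ (norm_nonneg _) (norm_le_pi_norm v i) 2
  simpa using this

lemma sqnorm_nonneg {n : ℕ} (v : Fin n → ℝ) : 0 ≤ sqnorm v :=
  Finset.sum_nonneg fun _ _ => sq_nonneg _

/-- The column space of `X_τ`. -/
def colW {n p : ℕ} (X : Matrix (Fin n) (Fin p) ℝ) (τ : Finset (Fin p)) :
    Submodule ℝ (Fin n → ℝ) :=
  Submodule.span ℝ ((fun j => X.col j) '' (τ : Set (Fin p)))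

lemma mask_mem {n p : ℕ} (X : Matrix (Fin n) (Fin p) ℝ) (τ : Finset (Fin p)) (β : Fin p → ℝ) :
    X.mulVec (maskOn τ β) ∈ colW X τ := by
  rw [Matrix.mulVec_eq_sum]
  refine Submodule.sum_mem _ fun j _ => ?_
  by_cases hj : j ∈ τ
  · rw [op_smul_eq_smul]
    exact Submodule.smul_mem _ _ (Submodule.subset_span (Set.mem_image_of_mem (fun j => X.col j) hj))
  · simp [maskOn, hj]

lemma mem_mask {n p : ℕ} (X : Matrix (Fin n) (Fin p) ℝ) (τ : Finset (Fin p)) (v : Fin n → ℝ)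
    (hv : v ∈ colW X τ) : ∃ β, X.mulVec (maskOn τ β) = v := by
  induction hv using Submodule.span_induction with
  | mem x hx =>
    obtain ⟨j, hj, rfl⟩ := hx
    refine ⟨Pi.single j 1, ?_⟩
    have : maskOn τ (Pi.single j (1:ℝ)) = Pi.single j 1 := by
      ext i
      by_cases h : i = j
      · subst h; simp [maskOn] at hj ⊢; simp [hj]
      · simp [maskOn, h]
    rw [this]; simp
  | zero => exact ⟨0, by
      have : maskOn τ (0 : Fin p → ℝ) = 0 := by ext; simp [maskOn]
      simp [this]⟩
  | add x y _ _ hx hy =>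
    obtain ⟨a, rfl⟩ := hx
    obtain ⟨b, rfl⟩ := hy
    refine ⟨a + b, ?_⟩
    rw [← Matrix.mulVec_add]; congr 1
    ext i; simp only [maskOn, Pi.add_apply]; split_ifs <;> simp
  | smul c x _ hx =>
    obtain ⟨a, rfl⟩ := hx
    refine ⟨c • a, ?_⟩
    rw [← Matrix.mulVec_smul]; congr 1
    ext i; simp [maskOn]

lemma colW_finrank {n p : ℕ} (X : Matrix (Fin n) (Fin p) ℝ) (τ : Finset (Fin p)) :
    Module.finrank ℝ (colW X τ) ≤ τ.card := by
  have := finrank_span_finset_le_card (R := ℝ) (τ.image fun j => X.col j)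
  rw [Finset.coe_image] at this
  exact this.trans Finset.card_image_le

lemma colW_sup_ne_top {n p : ℕ} (X : Matrix (Fin n) (Fin p) ℝ) (τ : Finset (Fin p))
    (x : Fin n → ℝ) (h : τ.card + 1 < n) : colW X τ ⊔ Submodule.span ℝ {x} ≠ ⊤ := by
  intro ht
  have h1 := Submodule.finrank_add_le_finrank_add_finrank (colW X τ) (Submodule.span ℝ {x})
  have h2 : Module.finrank ℝ (Submodule.span ℝ {x}) ≤ 1 := by
    have := finrank_span_finset_le_card (R := ℝ) ({x} : Finset (Fin n → ℝ))
    rw [Finset.coe_singleton, Finset.card_singleton] at this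
    exact this
  have h3 := colW_finrank X τ
  rw [ht, finrank_top] at h1
  simp at h1
  omega

lemma gauss_lb (m s : ℝ) (hm : 0 ≤ m) (hs : 0 ≤ s) (hs1 : s ≤ 1) (a : ℝ) (ha : |a| ≤ m) :
    ENNReal.ofReal (2 * gaussianPDFReal 0 1 (m + 1) * s) ≤
      gaussianReal 0 1 (Metric.closedBall a s) := by
  rw [gaussianReal_apply _ one_ne_zero]
  calc ENNReal.ofReal (2 * gaussianPDFReal 0 1 (m + 1) * s)
      = gaussianPDF 0 1 (m + 1) * volume (Metric.closedBall a s) := by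
        rw [Real.volume_closedBall, gaussianPDF, ← ENNReal.ofReal_mul (gaussianPDFReal_nonneg _ _ _)]
        congr 1; ring
    _ = ∫⁻ _ in Metric.closedBall a s, gaussianPDF 0 1 (m + 1) := by rw [setLIntegral_const]
    _ ≤ _ := by
        refine setLIntegral_mono' measurableSet_closedBall fun x hx => ?_
        refine ENNReal.ofReal_le_ofReal ?_
        rw [gaussianPDFReal, gaussianPDFReal]
        refine mul_le_mul_of_nonneg_left ?_ (by positivity)
        rw [Real.exp_le_exp]
        have hx' : |x| ≤ m + 1 := by
          rw [Metric.mem_closedBall, Real.dist_eq] at hx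
          have := abs_sub_abs_le_abs_sub x a
          linarith
        have := sq_le_sq' (abs_le.1 hx').1 (abs_le.1 hx').2
        simp only [sub_zero, NNReal.coe_one, mul_one]
        linarith

lemma stdGaussian_ball_lb {n : ℕ} (m s : ℝ) (hm : 0 ≤ m) (hs : 0 ≤ s) (hs1 : s ≤ 1)
    (u : Fin n → ℝ) (hu : ‖u‖ ≤ m) :
    ENNReal.ofReal ((2 * gaussianPDFReal 0 1 (m + 1) * s) ^ n) ≤
      stdGaussian n (Metric.closedBall u s) := by
  have h0 : 0 ≤ 2 * gaussianPDFReal 0 1 (m + 1) * s := by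
    have := gaussianPDFReal_nonneg 0 1 (m + 1); positivity
  rw [stdGaussian, Measure.pi_closedBall _ _ hs, ENNReal.ofReal_pow h0]
  have : ∏ _i : Fin n, ENNReal.ofReal (2 * gaussianPDFReal 0 1 (m + 1) * s) ≤
    ∏ i : Fin n, gaussianReal 0 1 (Metric.closedBall (u i) s) :=
    Finset.prod_le_prod' fun i _ => gauss_lb m s hm hs hs1 _ ((norm_le_pi_norm u i).trans hu)
  simpa using this

lemma joint_bound {n : ℕ} (d : ℕ) (B : Set (Fin n → ℝ)) (m s q δ : ℝ)
    (hB : ∀ u ∈ B, ‖u‖ ≤ m) (hq1 : q ≤ 1) (hδ : 0 ≤ δ)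
    (hBc : stdGaussian n Bᶜ ≤ ENNReal.ofReal δ)
    (hq : ∀ u : Fin n → ℝ, ‖u‖ ≤ m → ENNReal.ofReal q ≤ stdGaussian n (Metric.closedBall u s))
    (hq0 : 0 ≤ q)
    (S : Set ((Fin n → ℝ) × (Fin d → Fin n → ℝ)))
    (hS : ∀ ω ∈ S, ω.1 ∈ B → ∀ b, ω.2 b ∉ Metric.closedBall ω.1 s) :
    jointMeasure n d S ≤ ENNReal.ofReal ((1 - q) ^ d + δ) := by
  set T : Set ((Fin n → ℝ) × (Fin d → Fin n → ℝ)) :=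
    {ω | ‖ω.1‖ ≤ m ∧ ∀ b, s < dist (ω.2 b) ω.1} with hT
  have hTm : MeasurableSet T := by
    have e : T = {ω | ‖ω.1‖ ≤ m} ∩ ⋂ b, {ω | s < dist (ω.2 b) ω.1} := by
      ext ω; simp [hT]
    rw [e]
    refine (measurableSet_le (by fun_prop) (by fun_prop)).inter
      (MeasurableSet.iInter fun b => measurableSet_lt (by fun_prop) ?_)
    exact (((measurable_pi_apply b).comp measurable_snd).dist measurable_fst)
  have hsub : S ⊆ (Bᶜ ×ˢ Set.univ) ∪ T := by
    intro ω hω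
    by_cases h : ω.1 ∈ B
    · right
      refine ⟨hB _ h, fun b => ?_⟩
      simpa using hS ω hω h b
    · left; exact ⟨h, trivial⟩
  have hTb : jointMeasure n d T ≤ ENNReal.ofReal ((1 - q) ^ d) := by
    rw [jointMeasure, Measure.prod_apply hTm]
    calc _ ≤ ∫⁻ _ , ENNReal.ofReal ((1 - q) ^ d) ∂(stdGaussian n) := by
          refine lintegral_mono fun u => ?_
          by_cases hu : ‖u‖ ≤ m
          · have hs : Prod.mk u ⁻¹' T ⊆ Set.univ.pi fun _ : Fin d => (Metric.closedBall u s)ᶜ := by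
              intro v hv b _
              simpa using hv.2 b
            refine (measure_mono hs).trans ?_
            rw [Measure.pi_pi, Finset.prod_const, Finset.card_univ, Fintype.card_fin,
              ENNReal.ofReal_pow (by linarith)]
            refine pow_le_pow_left' ?_ d
            rw [prob_compl_eq_one_sub measurableSet_closedBall, ENNReal.ofReal_sub _ hq0,
              ENNReal.ofReal_one]
            exact tsub_le_tsub_left (hq u hu) 1
          · have : Prod.mk u ⁻¹' T = ∅ := by
              ext v; simp [hT, hu]
            rw [this]; simp
      _ = _ := by simp
  calc jointMeasure n d S ≤ jointMeasure n d (Bᶜ ×ˢ Set.univ) + jointMeasure n d T :=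
        (measure_mono hsub).trans (measure_union_le _ _)
    _ ≤ ENNReal.ofReal δ + ENNReal.ofReal ((1 - q) ^ d) := by
        refine add_le_add ?_ hTb
        rw [jointMeasure, Measure.prod_prod]
        simpa using hBc
    _ = _ := by
        rw [add_comm, ENNReal.ofReal_add (pow_nonneg (by linarith) _) hδ]

/-- The good set of noise vectors, at level `m`. -/
def goodB {n p : ℕ} (X : Matrix (Fin n) (Fin p) ℝ) (τ₀ : Finset (Fin p)) (x : Fin n → ℝ)
    (σ : ℝ) (m : ℕ) : Set (Fin n → ℝ) :=
  {u | ‖u‖ ≤ m ∧ ∀ τ : Finset (Fin p), τ.card ≤ τ₀.card → τ ≠ τ₀ →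
    ∀ e : Fin n → ℝ, ‖e‖ ≤ 1 / ((m : ℝ) + 1) → ∀ w ∈ colW X τ, ∀ s : ℝ,
      1 / ((m : ℝ) + 1) ≤ ‖x + σ • u - w - s • (u + e)‖ ^ 2}

lemma goodB_closed {n p : ℕ} (X : Matrix (Fin n) (Fin p) ℝ) (τ₀ : Finset (Fin p))
    (x : Fin n → ℝ) (σ : ℝ) (m : ℕ) : IsClosed (goodB X τ₀ x σ m) := by
  simp only [goodB, Set.ofPred_and, Set.ofPred_forall]
  refine IsClosed.inter (isClosed_le (by fun_prop) (by fun_prop)) ?_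
  repeat refine isClosed_iInter fun _ => ?_
  exact isClosed_le (by fun_prop) (by fun_prop)

lemma goodB_mono {n p : ℕ} (X : Matrix (Fin n) (Fin p) ℝ) (τ₀ : Finset (Fin p))
    (x : Fin n → ℝ) (σ : ℝ) : Monotone (goodB X τ₀ x σ) := by
  intro a b hab u hu
  have hab' : (a : ℝ) ≤ b := by exact_mod_cast hab
  have h : 1 / ((b : ℝ) + 1) ≤ 1 / ((a : ℝ) + 1) := by gcongr
  exact ⟨hu.1.trans hab', fun τ h1 h2 e he w hw s => h.trans (hu.2 τ h1 h2 e (he.trans h) w hw s)⟩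

lemma mem_goodB {n p : ℕ} (X : Matrix (Fin n) (Fin p) ℝ) (τ₀ : Finset (Fin p))
    (x : Fin n → ℝ) (σ : ℝ) (hσ : 0 < σ) (u : Fin n → ℝ)
    (h : ∀ τ : Finset (Fin p), τ.card ≤ τ₀.card → τ ≠ τ₀ →
      x ∉ colW X τ ∧ u ∉ colW X τ ⊔ Submodule.span ℝ {x}) : ∃ m, u ∈ goodB X τ₀ x σ m := by
  have h1 : ∀ τ : Finset (Fin p), ∃ ε : ℝ, 0 < ε ∧ (τ.card ≤ τ₀.card → τ ≠ τ₀ →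
      ∀ e : Fin n → ℝ, ‖e‖ ≤ ε → ∀ w ∈ colW X τ, ∀ s : ℝ,
      ε ≤ ‖x + σ • u - w - s • (u + e)‖ ^ 2) := by
    intro τ
    by_cases hc : τ.card ≤ τ₀.card ∧ τ ≠ τ₀
    · obtain ⟨ε, he, H⟩ := fit_lb (colW X τ) x u σ hσ (h τ hc.1 hc.2).1 (h τ hc.1 hc.2).2
      exact ⟨ε, he, fun _ _ => H⟩
    · exact ⟨1, one_pos, fun a b => absurd ⟨a, b⟩ hc⟩
  choose ε hε H using h1
  have h2 : ∀ᶠ m : ℕ in atTop, ∀ τ, 1 / ((m : ℝ) + 1) ≤ ε τ := by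
    rw [Filter.eventually_all]
    intro τ
    exact (tendsto_one_div_add_atTop_nhds_zero_nat (𝕜 := ℝ)).eventually_le_const (hε τ)
  obtain ⟨m, hm, hm2⟩ := (h2.and (tendsto_natCast_atTop_atTop.eventually_ge_atTop ‖u‖)).exists
  exact ⟨m, hm2, fun τ a b e he w hw s => (hm τ).trans (H τ a b e (he.trans (hm τ)) w hw s)⟩

lemma exists_good {n p : ℕ} (X : Matrix (Fin n) (Fin p) ℝ) (τ₀ : Finset (Fin p))
    (x : Fin n → ℝ) (σ : ℝ) (hσ : 0 < σ) (hn : τ₀.card + 4 < n)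
    (hx : ∀ τ : Finset (Fin p), τ.card ≤ τ₀.card → τ ≠ τ₀ → x ∉ colW X τ)
    (δ : ℝ) (hδ : 0 < δ) :
    ∃ m, stdGaussian n (goodB X τ₀ x σ m)ᶜ ≤ ENNReal.ofReal δ := by
  have hanti : Antitone fun m => (goodB X τ₀ x σ m)ᶜ := fun a b hab =>
    Set.compl_subset_compl.2 (goodB_mono X τ₀ x σ hab)
  have ht := tendsto_measure_iInter_atTop (μ := stdGaussian n)
    (fun m => (goodB_closed X τ₀ x σ m).measurableSet.compl.nullMeasurableSet) hanti
    ⟨0, measure_ne_top _ _⟩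
  have h0 : stdGaussian n (⋂ m, (goodB X τ₀ x σ m)ᶜ) = 0 := by
    refine measure_mono_null (t := ⋃ τ : Finset (Fin p), if τ.card ≤ τ₀.card then
      ((colW X τ ⊔ Submodule.span ℝ {x} : Submodule ℝ (Fin n → ℝ)) : Set (Fin n → ℝ))
        else ∅) ?_ ?_
    · intro u hu
      by_contra hc
      simp only [Set.mem_iUnion, not_exists] at hc
      obtain ⟨m, hm⟩ := mem_goodB X τ₀ x σ hσ u (fun τ h1 h2 => ⟨hx τ h1 h2, by
        have := hc τ
        rw [if_pos h1] at this
        exact this⟩)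
      exact Set.mem_iInter.1 hu m hm
    · refine measure_iUnion_null fun τ => ?_
      split_ifs with h
      · exact stdGaussian_submodule _ (colW_sup_ne_top X τ x (by omega))
      · simp
  rw [h0] at ht
  exact (ht.eventually_le_const (ENNReal.ofReal_pos.2 hδ)).exists

lemma obj_bdd {n p : ℕ} (X : Matrix (Fin n) (Fin p) ℝ) (y u : Fin n → ℝ) (τ : Finset (Fin p)) :
    BddBelow (Set.range fun bs : (Fin p → ℝ) × ℝ =>
      sqnorm (y - X.mulVec (maskOn τ bs.1) - bs.2 • u)) :=
  ⟨0, by rintro _ ⟨_, rfl⟩; exact sqnorm_nonneg _⟩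

/-- Deterministic selection step. -/
lemma select {n p : ℕ} (X : Matrix (Fin n) (Fin p) ℝ) (τ₀ : Finset (Fin p)) (β₀ : Fin p → ℝ)
    (hβsupp : ∀ j ∉ τ₀, β₀ j = 0) (σ₀ : ℝ) (m : ℕ) (s lam : ℝ)
    (hs : s ≤ 1 / ((m : ℝ) + 1)) (hlam : σ₀ ^ 2 * n * s ^ 2 < lam)
    (hlam2 : σ₀ ^ 2 * n * s ^ 2 + lam * τ₀.card < 1 / ((m : ℝ) + 1))
    (u v : Fin n → ℝ) (hu : u ∈ goodB X τ₀ (X.mulVec β₀) σ₀ m)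
    (hv : v ∈ Metric.closedBall u s) (τ : Finset (Fin p))
    (hτ : objPen X lam (X.mulVec β₀ + σ₀ • u) v τ ≤ objPen X lam (X.mulVec β₀ + σ₀ • u) v τ₀) :
    τ = τ₀ := by
  by_contra hne
  have hs0 : ‖v - u‖ ≤ s := by rwa [Metric.mem_closedBall, dist_eq_norm] at hv
  have hl0 : 0 < lam := lt_of_le_of_lt (by positivity) hlam
  have hup : objPen X lam (X.mulVec β₀ + σ₀ • u) v τ₀ ≤ σ₀ ^ 2 * n * s ^ 2 + lam * τ₀.card := by
    refine add_le_add (ciInf_le_of_le (obj_bdd X _ v τ₀) (β₀, σ₀) ?_) le_rfl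
    have hmask : maskOn τ₀ β₀ = β₀ := by
      ext j; simp only [maskOn]; split_ifs with h
      · rfl
      · exact (hβsupp j h).symm
    have : X.mulVec β₀ + σ₀ • u - X.mulVec (maskOn τ₀ β₀) - σ₀ • v = (-σ₀) • (v - u) := by
      rw [hmask]; module
    simp only [this]
    refine (sqnorm_le _).trans ?_
    rw [norm_smul, mul_pow, Real.norm_eq_abs, sq_abs, neg_sq]
    have := pow_le_pow_left₀ (norm_nonneg _) hs0 2
    calc (n : ℝ) * (σ₀ ^ 2 * ‖v - u‖ ^ 2) ≤ n * (σ₀ ^ 2 * s ^ 2) := by gcongr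
      _ = _ := by ring
  rcases le_or_gt τ.card τ₀.card with hc | hc
  · have hlo : 1 / ((m : ℝ) + 1) ≤ objPen X lam (X.mulVec β₀ + σ₀ • u) v τ := by
      have : 1 / ((m : ℝ) + 1) ≤ ⨅ bs : (Fin p → ℝ) × ℝ,
          sqnorm (X.mulVec β₀ + σ₀ • u - X.mulVec (maskOn τ bs.1) - bs.2 • v) := by
        refine le_ciInf fun bs => ?_
        have := hu.2 τ hc hne (v - u) (hs0.trans hs) _ (mask_mem X τ bs.1) bs.2
        rw [add_sub_cancel] at this
        exact this.trans (norm_sq_le_sqnorm _)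
      have h2 : 0 ≤ lam * τ.card := by positivity
      unfold objPen; linarith
    linarith
  · have hlo : lam * τ.card ≤ objPen X lam (X.mulVec β₀ + σ₀ • u) v τ := by
      have : 0 ≤ ⨅ bs : (Fin p → ℝ) × ℝ,
          sqnorm (X.mulVec β₀ + σ₀ • u - X.mulVec (maskOn τ bs.1) - bs.2 • v) :=
        le_ciInf fun bs => sqnorm_nonneg _
      unfold objPen; linarith
    have hc' : (τ₀.card : ℝ) + 1 ≤ τ.card := by exact_mod_cast hc
    nlinarith

lemma c0_pos {n p : ℕ} (τ₀ : Finset (Fin p)) (hn : τ₀.card + 4 < n) :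
    0 < 2 + 2 * ((τ₀.card : ℝ) + 1) * Real.log ((p : ℝ)/2) / (n : ℝ) := by
  have hn' : (τ₀.card : ℝ) + 4 < n := by exact_mod_cast hn
  have hk : (0 : ℝ) ≤ τ₀.card := by positivity
  have hn0 : (0 : ℝ) < n := by linarith
  have hlog : -1 ≤ Real.log ((p : ℝ)/2) := by
    rcases Nat.eq_zero_or_pos p with h | h
    · subst h; simp
    · have h1 : (1 : ℝ) ≤ p := by exact_mod_cast h
      have h2 : Real.log (1 / 2) ≤ Real.log ((p : ℝ)/2) :=
        Real.log_le_log (by norm_num) (by linarith)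
      have h3 : Real.log (1 / 2) = - Real.log 2 := by rw [one_div, Real.log_inv]
      have := Real.log_two_lt_d9
      linarith
  have : -2 < 2 * ((τ₀.card : ℝ) + 1) * Real.log ((p : ℝ)/2) / (n : ℝ) := by
    rw [lt_div_iff₀ hn0]
    nlinarith
  linarith

/-- The main theorem in a stronger form: the bound holds for *every* sufficiently small
`γ = t ^ 4` (for which the window for the tuning parameter is nonempty when `Cmin > 0`). -/
theorem main_small {n p : ℕ}
    (X : Matrix (Fin n) (Fin p) ℝ) (τ₀ : Finset (Fin p)) (β₀ : Fin p → ℝ)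
    (hβsupp : ∀ j ∉ τ₀, β₀ j = 0) (σ₀ : ℝ) (hσ₀ : 0 < σ₀)
    (hid : Identifiable X τ₀ β₀)
    (hn : τ₀.card + 4 < n)
    (δ : ℝ) (hδ : 0 < δ) :
    ∀ᶠ t : ℝ in nhdsWithin 0 (Set.Ioi 0), (0 < t ∧ t < 1) ∧
      ∀ lam : ℝ,
        lam ∈ Set.Icc
          ((n : ℝ) * t ^ 2 *
            (2 + 2 * ((τ₀.card : ℝ) + 1) * Real.log ((p : ℝ)/2) / (n : ℝ)))
          ((n : ℝ) * t * Cmin X τ₀ β₀ / 6) →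
        ∀ tauHat : (Fin n → ℝ) → (Fin n → ℝ) → Finset (Fin p),
          (∀ (y ustar : Fin n → ℝ) (τ : Finset (Fin p)),
            objPen X lam y ustar (tauHat y ustar) ≤ objPen X lam y ustar τ) →
          ∀ d : ℕ,
            jointMeasure n d
              {ω | ∀ b : Fin d, tauHat (X.mulVec β₀ + σ₀ • ω.1) (ω.2 b) ≠ τ₀} ≤
              ENNReal.ofReal ((1 - (t ^ 4) ^ (n - 1) / ((n : ℝ) - 1)) ^ d + δ) := by
  have hx : ∀ τ : Finset (Fin p), τ.card ≤ τ₀.card → τ ≠ τ₀ → X.mulVec β₀ ∉ colW X τ := by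
    intro τ h1 h2 h3
    have := hid τ (mem_mask X τ _ h3) h2
    omega
  obtain ⟨m, hm⟩ := exists_good X τ₀ (X.mulVec β₀) σ₀ hσ₀ hn hx δ hδ
  have hc0 := c0_pos τ₀ hn
  set c0 := 2 + 2 * ((τ₀.card : ℝ) + 1) * Real.log ((p : ℝ)/2) / (n : ℝ)
  have hn0 : (5 : ℝ) ≤ n := by
    have : 5 ≤ n := by omega
    exact_mod_cast this
  set c := 2 * gaussianPDFReal 0 1 ((m : ℝ) + 1) with hc
  have hcpos : 0 < c := mul_pos two_pos (gaussianPDFReal_pos _ _ _ one_ne_zero)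
  have hε : (0 : ℝ) < 1 / ((m : ℝ) + 1) := by positivity
  have ev : ∀ (f : ℝ → ℝ) (a : ℝ), Continuous f → f 0 < a →
      ∀ᶠ t : ℝ in nhdsWithin 0 (Set.Ioi 0), f t < a := fun f a hf h0 =>
    ((hf.tendsto 0).mono_left nhdsWithin_le_nhds).eventually_lt_const h0
  filter_upwards [self_mem_nhdsWithin, ev (fun t => t) 1 (by fun_prop) (by norm_num),
    ev (fun t => σ₀ ^ 2 * t ^ 2) c0 (by fun_prop) (by simpa using hc0),
    ev (fun t => t ^ 2) (1 / ((m : ℝ) + 1)) (by fun_prop) (by simpa using hε),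
    ev (fun t => σ₀ ^ 2 * n * (t ^ 2) ^ 2 + (n * t * Cmin X τ₀ β₀ / 6) * τ₀.card) (1 / ((m : ℝ) + 1))
      (by fun_prop) (by simpa using hε),
    ev (fun t => t) (c ^ n) (by fun_prop) (by positivity)] with t ht ht1 h2 h3 h4 h5
  have ht : 0 < t := ht
  refine ⟨⟨ht, ht1⟩, ?_⟩
  intro lam hlam tauHat hmin d
  have hpow1 : (t ^ 4) ^ (n - 1) ≤ 1 := pow_le_one₀ (by positivity) (pow_le_one₀ ht.le ht1.le)
  have hq1 : (t ^ 4) ^ (n - 1) / ((n : ℝ) - 1) ≤ (t ^ 4) ^ (n - 1) :=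
    div_le_self (by positivity) (by linarith)
  refine joint_bound d (goodB X τ₀ (X.mulVec β₀) σ₀ m) m (t ^ 2) _ δ (fun u hu => hu.1)
    (hq1.trans hpow1) hδ.le hm ?_ (div_nonneg (by positivity) (by linarith)) _ ?_
  · intro u hu
    refine le_trans (ENNReal.ofReal_le_ofReal ?_) (stdGaussian_ball_lb (m : ℝ) (t ^ 2)
      (by positivity) (by positivity) (pow_le_one₀ ht.le ht1.le) u hu)
    refine hq1.trans ?_
    rw [← hc, mul_pow, ← pow_mul, ← pow_mul]
    calc t ^ (4 * (n - 1)) ≤ t ^ (2 * n + 1) := pow_le_pow_of_le_one ht.le ht1.le (by omega)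
      _ = t * t ^ (2 * n) := by ring
      _ ≤ c ^ n * t ^ (2 * n) := by gcongr
  · intro ω hω hB b hb
    refine hω b (select X τ₀ β₀ hβsupp σ₀ m (t ^ 2) lam h3.le ?_ ?_ ω.1 (ω.2 b) hB hb _
      (hmin _ _ _))
    · refine lt_of_lt_of_le ?_ hlam.1
      have : σ₀ ^ 2 * t ^ 2 * (n * t ^ 2) < c0 * (n * t ^ 2) := by gcongr
      linarith
    · refine lt_of_le_of_lt ?_ h4
      have := mul_le_mul_of_nonneg_right hlam.2 (Nat.cast_nonneg (α := ℝ) τ₀.card)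
      linarith

/-- **Theorem 2.1.** Finite-`n` bound for the penalized repro-samples candidate set:
for any `δ > 0` there is `γ_δ > 0` such that, for any tuning parameter `λ` in the
prescribed window and any measurable choice `τ̂` of minimizers of the penalized
objective, `ℙ(τ₀ ∉ S^(d)) ≤ (1 − γ_δ^{n−1}/(n−1))^d + δ`; consequently, as `d → ∞`
the non-coverage probability is eventually at most (any number above) `δ`. -/
theorem model_candidate_set_finite_sample {n p : ℕ}
    (X : Matrix (Fin n) (Fin p) ℝ) (τ₀ : Finset (Fin p)) (β₀ : Fin p → ℝ)
    (hβsupp : ∀ j ∉ τ₀, β₀ j = 0) (hβne : ∀ j ∈ τ₀, β₀ j ≠ 0)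
    (σ₀ : ℝ) (hσ₀ : 0 < σ₀)
    (hGram : ∀ τ : Finset (Fin p), τ.card ≤ τ₀.card →
      IsUnit ((subcols X τ)ᵀ * subcols X τ).det)
    (hid : Identifiable X τ₀ β₀)
    (hn : τ₀.card + 4 < n)
    (δ : ℝ) (hδ : 0 < δ) :
    ∃ γδ : ℝ, 0 < γδ ∧
      ∀ lam : ℝ,
        lam ∈ Set.Icc
          ((n : ℝ) * γδ ^ ((1 : ℝ)/2) *
            (2 + 2 * ((τ₀.card : ℝ) + 1) * Real.log ((p : ℝ)/2) / (n : ℝ)))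
          ((n : ℝ) * γδ ^ ((1 : ℝ)/4) * Cmin X τ₀ β₀ / 6) →
        ∀ tauHat : (Fin n → ℝ) → (Fin n → ℝ) → Finset (Fin p),
          (∀ (y ustar : Fin n → ℝ) (τ : Finset (Fin p)),
            objPen X lam y ustar (tauHat y ustar) ≤ objPen X lam y ustar τ) →
          (∀ d : ℕ,
            jointMeasure n d
              {ω | ∀ b : Fin d, tauHat (X.mulVec β₀ + σ₀ • ω.1) (ω.2 b) ≠ τ₀} ≤
              ENNReal.ofReal ((1 - γδ ^ (n - 1) / ((n : ℝ) - 1)) ^ d + δ)) ∧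
          Filter.limsup (fun d : ℕ =>
              jointMeasure n d
                {ω | ∀ b : Fin d, tauHat (X.mulVec β₀ + σ₀ • ω.1) (ω.2 b) ≠ τ₀})
            Filter.atTop ≤ ENNReal.ofReal δ := by
  have hne : (nhdsWithin (0 : ℝ) (Set.Ioi 0)).NeBot := inferInstance
  obtain ⟨t, ⟨ht0, ht1⟩, H⟩ := (main_small X τ₀ β₀ hβsupp σ₀ hσ₀ hid hn δ hδ).exists
  have e2 : (t ^ 4) ^ ((1 : ℝ) / 2) = t ^ 2 := by
    rw [← Real.sqrt_eq_rpow, show t ^ 4 = (t ^ 2) ^ 2 by ring, Real.sqrt_sq (by positivity)]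
  have e4 : (t ^ 4) ^ ((1 : ℝ) / 4) = t := by
    have := Real.pow_rpow_inv_natCast ht0.le (n := 4) (by norm_num)
    rw [one_div]
    exact_mod_cast this
  refine ⟨t ^ 4, by positivity, ?_⟩
  rw [e2, e4]
  intro lam hlam tauHat hmin
  have hb := H lam hlam tauHat hmin
  refine ⟨hb, ?_⟩
  have hn0 : (5 : ℝ) ≤ n := by
    have : 5 ≤ n := by omega
    exact_mod_cast this
  have hq0 : 0 < (t ^ 4) ^ (n - 1) / ((n : ℝ) - 1) := div_pos (by positivity) (by linarith)
  have hq1 : (t ^ 4) ^ (n - 1) / ((n : ℝ) - 1) ≤ 1 :=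
    (div_le_self (by positivity) (by linarith)).trans
      (pow_le_one₀ (by positivity) (pow_le_one₀ ht0.le ht1.le))
  have hlim : Tendsto (fun d : ℕ =>
      ENNReal.ofReal ((1 - (t ^ 4) ^ (n - 1) / ((n : ℝ) - 1)) ^ d + δ)) atTop
      (nhds (ENNReal.ofReal δ)) := by
    refine ENNReal.tendsto_ofReal ?_
    have := (tendsto_pow_atTop_nhds_zero_of_lt_one (sub_nonneg.2 hq1)
      (sub_lt_self 1 hq0)).add_const δ
    simpa using this
  exact (Filter.limsup_le_limsup (Eventually.of_forall hb)).trans hlim.limsup_eq.le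

end ReproSamples
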